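/- Let 0 < α < 1 and let a < b be real numbers. Then ∫_a^b ∫_{ℝ∖(a,b)} |x−y|^{−(1+α)} dy dx = 2·(b−a)^{1−α}/(α·(1−α)). -/

import Mathlib

open MeasureTheory Filter Set ProbabilityTheory

lemma integrableOn_Ici_abs_rpow {α c : ℝ} (hα : 0 < α) (hc : 0 < c) :
    IntegrableOn (fun t : ℝ => |t| ^ (-(1 + α))) (Ici c) := by
  rw [integrableOn_Ici_iff_integrableOn_Ioi]
  refine (integrableOn_Ioi_rpow_of_lt (by linarith : -(1 + α) < -1) hc).congr_fun
    (fun t ht => ?_) measurableSet_Ioi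
  simp only [abs_of_pos (hc.trans ht)]

lemma integral_Ici_abs_rpow {α c : ℝ} (hα : 0 < α) (hc : 0 < c) :
    ∫ t in Ici c, |t| ^ (-(1 + α)) = c ^ (-α) / α := by
  rw [integral_Ici_eq_integral_Ioi,
    setIntegral_congr_fun (g := fun t : ℝ => t ^ (-(1 + α))) measurableSet_Ioi
      (fun t ht => by simp only [abs_of_pos (hc.trans ht)]),
    integral_Ioi_rpow_of_lt (by linarith) hc, show -(1 + α) + 1 = -α by ring, neg_div_neg_eq]

lemma integral_compl_Ioo_abs_sub_rpow {α a b x : ℝ} (hα : 0 < α) (hx : x ∈ Ioo a b) :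
    ∫ y in (Ioo a b)ᶜ, |x - y| ^ (-(1 + α)) = (x - a) ^ (-α) / α + (b - x) ^ (-α) / α := by
  have hxa : 0 < x - a := sub_pos.2 hx.1
  have hbx : 0 < b - x := sub_pos.2 hx.2
  have hleft : MeasurePreserving (fun y : ℝ => x - y) :=
    Measure.measurePreserving_sub_left volume x
  have hleft_emb : MeasurableEmbedding (fun y : ℝ => x - y) :=
    (Homeomorph.subLeft x).measurableEmbedding
  have hright : MeasurePreserving (fun y : ℝ => y - x) :=
    measurePreserving_sub_right volume x
  have hright_emb : MeasurableEmbedding (fun y : ℝ => y - x) :=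
    (Homeomorph.subRight x).measurableEmbedding
  have hIic : (fun y : ℝ => x - y) ⁻¹' Ici (x - a) = Iic a := by ext y; simp
  have hIci : (fun y : ℝ => y - x) ⁻¹' Ici (b - x) = Ici b := by ext y; simp
  have hcompl : (Ioo a b)ᶜ = Iic a ∪ Ici b := by
    rw [← Ioi_inter_Iio, compl_inter, compl_Ioi, compl_Iio]
  have hdisj : Disjoint (Iic a) (Ici b) :=
    Iic_disjoint_Ici.2 (not_le.2 (hx.1.trans hx.2))
  have hint_left : IntegrableOn (fun y => |x - y| ^ (-(1 + α))) (Iic a) := by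
    rw [← hIic]
    exact (hleft.integrableOn_comp_preimage hleft_emb).2 (integrableOn_Ici_abs_rpow hα hxa)
  have hint_right : IntegrableOn (fun y => |x - y| ^ (-(1 + α))) (Ici b) := by
    simp only [abs_sub_comm x]
    rw [← hIci]
    exact (hright.integrableOn_comp_preimage hright_emb).2 (integrableOn_Ici_abs_rpow hα hbx)
  rw [hcompl, setIntegral_union hdisj measurableSet_Ici hint_left hint_right]
  congr 1
  · rw [← hIic, hleft.setIntegral_preimage_emb hleft_emb (fun t => |t| ^ (-(1 + α))),
      integral_Ici_abs_rpow hα hxa]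
  · simp only [abs_sub_comm x]
    rw [← hIci, hright.setIntegral_preimage_emb hright_emb (fun t => |t| ^ (-(1 + α))),
      integral_Ici_abs_rpow hα hbx]

/-- **Equation (5.2).** For `0 < α < 1` and `a < b`, the fractional `α`-perimeter of
`(a,b)` equals `2 (b−a)^{1−α} / (α(1−α))`. -/
theorem fractional_perimeter_interval
    (α : ℝ) (hα0 : 0 < α) (hα1 : α < 1)
    (a b : ℝ) (hab : a < b) :
    ∫ x in Ioo a b, ∫ y in (Ioo a b)ᶜ, |x - y| ^ (-(1 + α))
      = 2 * (b - a) ^ (1 - α) / (α * (1 - α)) := by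
  have hint (c d : ℝ) : IntervalIntegrable (fun t : ℝ => t ^ (-α)) volume c d :=
    intervalIntegral.intervalIntegrable_rpow' (by linarith)
  have hint_left : IntervalIntegrable (fun x => (x - a) ^ (-α)) volume a b := by
    simpa using (hint 0 (b - a)).comp_sub_right a
  have hint_right : IntervalIntegrable (fun x => (b - x) ^ (-α)) volume a b := by
    simpa using (hint (b - a) 0).comp_sub_left b
  have hpow : ∫ t in (0 : ℝ)..(b - a), t ^ (-α) = (b - a) ^ (1 - α) / (1 - α) := by
    rw [integral_rpow (Or.inl (by linarith)), show -α + 1 = 1 - α by ring,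
      Real.zero_rpow (by linarith), sub_zero]
  rw [setIntegral_congr_fun measurableSet_Ioo
      (fun x hx => integral_compl_Ioo_abs_sub_rpow hα0 hx),
    ← integral_Ioc_eq_integral_Ioo, ← intervalIntegral.integral_of_le hab.le,
    intervalIntegral.integral_add (hint_left.div_const α) (hint_right.div_const α),
    intervalIntegral.integral_div, intervalIntegral.integral_div,
    intervalIntegral.integral_comp_sub_right (fun t => t ^ (-α)),
    intervalIntegral.integral_comp_sub_left (fun t => t ^ (-α)), sub_self, sub_self, hpow]
  have : 1 - α ≠ 0 := by linarith
  field_simp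
  ring
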